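/- Let g be the Kac-Moody algebra of an indecomposable symmetrizable generalized Cartan matrix A indexed by I, ρ: I → Ī an admissible quotient map, and g^ρ the associated Kac-Moody subalgebra with Cartan subalgebra a and root system Δ^ρ. Then g is maximally finitely Δ^ρ-graded with grading subalgebra g^ρ; in particular ρ_a(Δ) = Δ^ρ, where ρ_a(α) denotes the restriction of α ∈ Δ to a, and the corresponding sets J and I'_im are empty. -/

import Mathlib

attribute [local instance] Classical.propDecidable

noncomputable section

namespace KMG

open Module

/-! ### Generalized Cartan matrices -/

/-- `A` is a generalized Cartan matrix. -/
def IsGCM {I : Type*} (A : Matrix I I ℤ) : Prop :=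
  (∀ i, A i i = 2) ∧ (∀ i j, i ≠ j → A i j ≤ 0) ∧ ∀ i j, A i j = 0 → A j i = 0

/-- `A` is indecomposable. -/
def Indecomposable {I : Type*} (A : Matrix I I ℤ) : Prop :=
  ∀ s : Set I, s.Nonempty → sᶜ.Nonempty → ∃ i ∈ s, ∃ j ∈ sᶜ, A i j ≠ 0

/-- `A` is symmetrizable: `D A` is symmetric for an invertible diagonal matrix `D`. -/
def Symmetrizable {I : Type*} (A : Matrix I I ℤ) : Prop :=
  ∃ d : I → ℚ, (∀ i, d i ≠ 0) ∧ ∀ i j, d i * (A i j : ℚ) = d j * (A j i : ℚ)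

/-- The principal submatrix of `A` indexed by a subset `S`. -/
def restrictM {I : Type*} (A : Matrix I I ℤ) (S : Set I) : Matrix S S ℤ :=
  fun i j => A i.1 j.1

/-- `A` is of finite type: `A u > 0` for some `u > 0` (Kac, Thm. 4.3). -/
def IsFiniteType {I : Type*} (A : Matrix I I ℤ) : Prop :=
  ∃ u : I → ℚ, (∀ i, 0 < u i) ∧ ∀ i, 0 < ∑ᶠ j, (A i j : ℚ) * u j

/-- `A` is of affine type: `A` indecomposable and `A u = 0` for some `u > 0`. -/
def IsAffineType {I : Type*} (A : Matrix I I ℤ) : Prop :=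
  Indecomposable A ∧ ∃ u : I → ℚ, (∀ i, 0 < u i) ∧ ∀ i, ∑ᶠ j, (A i j : ℚ) * u j = 0

/-- `A` is of indefinite type: `A u < 0` for some `u > 0`. -/
def IsIndefiniteType {I : Type*} (A : Matrix I I ℤ) : Prop :=
  ∃ u : I → ℚ, (∀ i, 0 < u i) ∧ ∀ i, ∑ᶠ j, (A i j : ℚ) * u j < 0

/-- The corank of a generalized Cartan matrix. -/
def gcmCorank {I : Type*} [Fintype I] [DecidableEq I] (A : Matrix I I ℤ) : ℕ :=
  Fintype.card I - (A.map ((↑) : ℤ → ℚ)).rank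

/-- The connected component of the vertex `k` in the subdiagram of the Dynkin diagram of `A`
with vertex set `S`. -/
def cmpnt {I : Type*} (A : Matrix I I ℤ) (S : Set I) (k : I) : Set I :=
  {i | i ∈ S ∧ Relation.ReflTransGen (fun x y => x ∈ S ∧ y ∈ S ∧ A x y ≠ 0) k i}

/-- `A` is hyperbolic: deleting any one vertex of the Dynkin diagram leaves a disjoint union
of diagrams of finite or affine type. -/
def IsHyperbolic {I : Type*} (A : Matrix I I ℤ) : Prop :=
  ∀ i₀ k : I, k ≠ i₀ →
    IsFiniteType (restrictM A (cmpnt A {i | i ≠ i₀} k)) ∨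
      IsAffineType (restrictM A (cmpnt A {i | i ≠ i₀} k))

/-- `A` is Lorentzian: `A` is nonsingular and its symmetrization has signature `(+,...,+,-)`. -/
def IsLorentzian {I : Type*} [Fintype I] [DecidableEq I] (A : Matrix I I ℤ) : Prop :=
  IsUnit (A.map ((↑) : ℤ → ℚ)).det ∧
    ∃ d : I → ℚ, (∀ i, 0 < d i) ∧ (∀ i j, d i * (A i j : ℚ) = d j * (A j i : ℚ)) ∧
      ∃ P : Matrix I I ℝ, IsUnit P.det ∧ ∃ i₀ : I,
        P.transpose * (Matrix.of fun i j => ((d i : ℝ) * (A i j : ℝ))) * P =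
          Matrix.diagonal fun i => if i = i₀ then (-1 : ℝ) else 1

/-! ### Weight spaces -/

variable {g : Type*} [LieRing g] [LieAlgebra ℂ g]

/-- The weight space of weight `χ` for the adjoint action on `g` of a space `V` mapping to `g`
by `ι`. -/
def wtSpaceι {V : Type*} [AddCommGroup V] [Module ℂ V] (ι : V →ₗ[ℂ] g)
    (χ : Module.Dual ℂ V) : Submodule ℂ g where
  carrier := {x | ∀ v : V, ⁅ι v, x⁆ = χ v • x}
  add_mem' := fun ha hb v => by rw [lie_add, ha v, hb v, smul_add]
  zero_mem' := fun v => by rw [lie_zero, smul_zero]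
  smul_mem' := fun c x hx v => by rw [lie_smul, hx v, smul_comm]

/-! ### Kac-Moody algebras -/

/-- A (symmetrizable) Kac-Moody algebra structure on the Lie algebra `g`, for the generalized
Cartan matrix `A` indexed by `I` : a realization `(H, root, coroot)` of `A` together with
Chevalley generators `e i`, `f i` satisfying the Chevalley-Serre relations, such that `g` is
generated by `H` and the `e i, f i`, is diagonalizable under `H`, with `0`-weight space `H`. -/
structure KacMoodyAlgebra {I : Type*} [Fintype I] [DecidableEq I] (A : Matrix I I ℤ)
    (g : Type*) [LieRing g] [LieAlgebra ℂ g] : Type _ where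
  H : Submodule ℂ g
  root : I → Module.Dual ℂ H
  coroot : I → H
  e : I → g
  f : I → g
  findimH : FiniteDimensional ℂ H
  finrankH : Module.finrank ℂ H = Fintype.card I + gcmCorank A
  indepRoot : LinearIndependent ℂ root
  indepCoroot : LinearIndependent ℂ coroot
  pairing : ∀ i j, root j (coroot i) = (A i j : ℂ)
  abelian : ∀ x y : H, ⁅(x : g), (y : g)⁆ = 0
  lie_e : ∀ (x : H) (i : I), ⁅(x : g), e i⁆ = root i x • e i
  lie_f : ∀ (x : H) (i : I), ⁅(x : g), f i⁆ = -(root i x) • f i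
  e_f : ∀ i j, ⁅e i, f j⁆ = if j = i then ((coroot i : g)) else 0
  serre_e : ∀ i j, i ≠ j →
    ((LieAlgebra.ad ℂ g (e i)) ^ (1 - A i j).toNat) (e j) = 0
  serre_f : ∀ i j, i ≠ j →
    ((LieAlgebra.ad ℂ g (f i)) ^ (1 - A i j).toNat) (f j) = 0
  generates : LieSubalgebra.lieSpan ℂ g ((H : Set g) ∪ Set.range e ∪ Set.range f) = ⊤
  weight_decomp : ⨆ χ : Module.Dual ℂ H, wtSpaceι H.subtype χ = ⊤
  zero_weight : wtSpaceι H.subtype (0 : Module.Dual ℂ H) = H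

variable {I : Type*} [Fintype I] [DecidableEq I] {A : Matrix I I ℤ}

/-- The root system of a Kac-Moody algebra: nonzero weights of the adjoint action of the
Cartan subalgebra. -/
def Delta (G : KacMoodyAlgebra A g) : Set (Module.Dual ℂ G.H) :=
  {χ | χ ≠ 0 ∧ wtSpaceι G.H.subtype χ ≠ ⊥}

/-- The positive roots with respect to the standard root basis. -/
def posRoots (G : KacMoodyAlgebra A g) : Set (Module.Dual ℂ G.H) :=
  {χ ∈ Delta G | ∃ c : I → ℕ, χ = ∑ i, (c i : ℂ) • G.root i}

/-- The real roots : the orbit of the simple roots under the Weyl group. -/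
inductive IsRealRoot (G : KacMoodyAlgebra A g) : Module.Dual ℂ G.H → Prop
  | simple (i : I) : IsRealRoot G (G.root i)
  | reflect (i : I) (χ : Module.Dual ℂ G.H) :
      IsRealRoot G χ → IsRealRoot G (χ - χ (G.coroot i) • G.root i)

/-- The subalgebra `g(S)` generated by the root spaces `g_{± α_i}`, `i ∈ S`. -/
def gS (G : KacMoodyAlgebra A g) (S : Set I) : LieSubalgebra ℂ g :=
  LieSubalgebra.lieSpan ℂ g ({x | ∃ i ∈ S, x = G.e i} ∪ {x | ∃ i ∈ S, x = G.f i})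

/-- The subspace `h^J = {h ∈ h | ⟨α_j, h⟩ = 0 ∀ j ∈ J}`. -/
def hJsub (G : KacMoodyAlgebra A g) (J : Set I) : Submodule ℂ G.H :=
  ⨅ j ∈ J, LinearMap.ker (G.root j)

/-- `Hk` is the canonical semisimple element attached to `k` and the component `S = I_k` :
it lies in the span of the coroots from `S` and satisfies `⟨α_i, H_k⟩ = 2 δ_{i,k}` on `S`. -/
def IsHGen (G : KacMoodyAlgebra A g) (S : Set I) (k : I) (Hk : G.H) : Prop :=
  Hk ∈ Submodule.span ℂ (G.coroot '' S) ∧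
    ∀ i ∈ S, G.root i Hk = if i = k then 2 else 0

/-- `g(S)` is `A₁`-graded by the `sl₂`-triple with semisimple element `Hk` :
`ad Hk` has only eigenvalues `0, 2, -2` on `g(S)`. -/
def A1GradedBy (G : KacMoodyAlgebra A g) (S : Set I) (Hk : g) : Prop :=
  ∀ x ∈ gS G S, x ∈ Module.End.eigenspace (LieAlgebra.ad ℂ g Hk) 0 ⊔
    Module.End.eigenspace (LieAlgebra.ad ℂ g Hk) 2 ⊔
      Module.End.eigenspace (LieAlgebra.ad ℂ g Hk) (-2)

/-- The pair `(I_k, J_k)` (for `I_k` the connected component of `k` in `J ∪ {k}`) is an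
irreducible `C`-admissible pair. -/
def CAdmissibleComponent (G : KacMoodyAlgebra A g) (J : Set I) (k : I) : Prop :=
  IsFiniteType (restrictM A (cmpnt A (J ∪ {k}) k)) ∧
    ∃ Hk : G.H, IsHGen G (cmpnt A (J ∪ {k}) k) k Hk ∧
      ∃ E F : g, E ∈ gS G (cmpnt A (J ∪ {k}) k) ∧ F ∈ gS G (cmpnt A (J ∪ {k}) k) ∧
        IsSl2Triple (Hk : g) E F ∧ A1GradedBy G (cmpnt A (J ∪ {k}) k) (Hk : g)

/-- The data of a `C`-admissible pair `(I, J)` : for each `k ∉ J`, the component `I_k` is of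
finite type and carries an `sl₂`-triple `(E_k, H_k, F_k)` which `A₁`-grades `g(I_k)`. -/
structure CAdmissibleData (G : KacMoodyAlgebra A g) (J : Set I) : Type _ where
  finJ : IsFiniteType (restrictM A J)
  Hc : {k : I // k ∉ J} → G.H
  E : {k : I // k ∉ J} → g
  F : {k : I // k ∉ J} → g
  finIk : ∀ k : {k : I // k ∉ J}, IsFiniteType (restrictM A (cmpnt A (J ∪ {k.1}) k.1))
  isHGen : ∀ k, IsHGen G (cmpnt A (J ∪ {k.1}) k.1) k.1 (Hc k)
  memE : ∀ k, E k ∈ gS G (cmpnt A (J ∪ {k.1}) k.1)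
  memF : ∀ k, F k ∈ gS G (cmpnt A (J ∪ {k.1}) k.1)
  sl2 : ∀ k, IsSl2Triple ((Hc k : g)) (E k) (F k)
  a1 : ∀ k, A1GradedBy G (cmpnt A (J ∪ {k.1}) k.1) ((Hc k : g))

/-- `(I,J)` is a `C`-admissible pair. -/
def CAdmissiblePair (G : KacMoodyAlgebra A g) (J : Set I) : Prop :=
  Nonempty (CAdmissibleData G J)

/-- The data of a `C`-admissible pair `(Itot, J)` for a subdiagram `Itot ⊆ I`. -/
structure CAdmissibleDataIn (G : KacMoodyAlgebra A g) (Itot J : Set I) : Type _ where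
  subJ : J ⊆ Itot
  finJ : IsFiniteType (restrictM A J)
  Hc : {k : I // k ∈ Itot ∧ k ∉ J} → G.H
  E : {k : I // k ∈ Itot ∧ k ∉ J} → g
  F : {k : I // k ∈ Itot ∧ k ∉ J} → g
  finIk : ∀ k : {k : I // k ∈ Itot ∧ k ∉ J},
    IsFiniteType (restrictM A (cmpnt A (J ∪ {k.1}) k.1))
  isHGen : ∀ k, IsHGen G (cmpnt A (J ∪ {k.1}) k.1) k.1 (Hc k)
  memE : ∀ k, E k ∈ gS G (cmpnt A (J ∪ {k.1}) k.1)
  memF : ∀ k, F k ∈ gS G (cmpnt A (J ∪ {k.1}) k.1)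
  sl2 : ∀ k, IsSl2Triple ((Hc k : g)) (E k) (F k)
  a1 : ∀ k, A1GradedBy G (cmpnt A (J ∪ {k.1}) k.1) ((Hc k : g))

/-- The `C`-admissible subalgebra `g^J` : generated by `h^J` and the `E_k, F_k`. -/
def CAdmissibleData.gJ {G : KacMoodyAlgebra A g} {J : Set I} (D : CAdmissibleData G J) :
    LieSubalgebra ℂ g :=
  LieSubalgebra.lieSpan ℂ g
    ((((hJsub G J).map G.H.subtype : Submodule ℂ g) : Set g) ∪ Set.range D.E ∪ Set.range D.F)

/-- `GJ` is "the" Kac-Moody structure on `g^J` associated to a `C`-admissible pair: its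
Cartan subalgebra is `h^J`, its coroots are the `H_k` and its Chevalley generators are the
`E_k, F_k`; the matrix `A'` is `A^J`, i.e. `a'_{k,l} = ⟨α_l, H_k⟩`. -/
def CAdmissibleData.IsAssocKM {G : KacMoodyAlgebra A g} {J : Set I} (D : CAdmissibleData G J)
    {A' : Matrix {k : I // k ∉ J} {k : I // k ∉ J} ℤ}
    (GJ : KacMoodyAlgebra A' ↥D.gJ) : Prop :=
  (∀ k l, (A' k l : ℂ) = G.root l.1 (D.Hc k)) ∧
  GJ.H.map D.gJ.toSubmodule.subtype = (hJsub G J).map G.H.subtype ∧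
  (∀ k, ((GJ.coroot k : ↥D.gJ) : g) = ((D.Hc k : ↥G.H) : g)) ∧
  (∀ k, ((GJ.e k : ↥D.gJ) : g) = D.E k) ∧ (∀ k, ((GJ.f k : ↥D.gJ) : g) = D.F k)

/-! ### Finite gradations -/

/-- `g` is finitely `Σ`-graded, where `Σ` is the root system of the Kac-Moody algebra `m`
(with Kac-Moody structure `M`) and `m` is embedded in `g` by `φ` (the grading subalgebra is
the image of `φ`): `g` is the sum of the weight spaces `V_γ`, `γ ∈ Σ ∪ {0}`, of the adjoint
action of the Cartan subalgebra of `m`, and each `V_γ` is finite dimensional. -/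
def IsFinGrading {S : Type*} [Fintype S] [DecidableEq S] {B : Matrix S S ℤ}
    {m : Type*} [LieRing m] [LieAlgebra ℂ m] (M : KacMoodyAlgebra B m)
    (φ : m →ₗ⁅ℂ⁆ g) : Prop :=
  Function.Injective φ ∧
  (⨆ χ ∈ insert (0 : Module.Dual ℂ M.H) (Delta M),
      wtSpaceι (φ.toLinearMap ∘ₗ M.H.subtype) χ) = ⊤ ∧
  ∀ χ ∈ insert (0 : Module.Dual ℂ M.H) (Delta M),
      FiniteDimensional ℂ (wtSpaceι (φ.toLinearMap ∘ₗ M.H.subtype) χ)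

section Grading

variable {S : Type*} [Fintype S] [DecidableEq S] {B : Matrix S S ℤ}
variable {m : Type*} [LieRing m] [LieAlgebra ℂ m]

/-- The inclusion of the Cartan subalgebra of the grading subalgebra into the Cartan
subalgebra of `g` (given `a ⊆ h`). -/
def cartanIncl (G : KacMoodyAlgebra A g) (M : KacMoodyAlgebra B m) (φ : m →ₗ⁅ℂ⁆ g)
    (hle : M.H.map φ.toLinearMap ≤ G.H) : M.H →ₗ[ℂ] G.H :=
  LinearMap.codRestrict G.H (φ.toLinearMap ∘ₗ M.H.subtype)
    (fun x => hle (Submodule.mem_map_of_mem x.2))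

/-- The restriction `ρ_a(χ)` to the Cartan subalgebra `a` of `m` of a linear form `χ` on `h`. -/
def resD (G : KacMoodyAlgebra A g) (M : KacMoodyAlgebra B m) (φ : m →ₗ⁅ℂ⁆ g)
    (hle : M.H.map φ.toLinearMap ≤ G.H) (χ : Module.Dual ℂ G.H) : Module.Dual ℂ M.H :=
  χ.comp (cartanIncl G M φ hle)

/-- The restriction `ρ_a(α_i)` of the simple root `α_i` to `a`. -/
def resRoot (G : KacMoodyAlgebra A g) (M : KacMoodyAlgebra B m) (φ : m →ₗ⁅ℂ⁆ g)
    (hle : M.H.map φ.toLinearMap ≤ G.H) (i : I) : Module.Dual ℂ M.H :=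
  resD G M φ hle (G.root i)

/-- The root basis of `M` is adapted to the root basis of `G` :
`ρ_a(Δ⁺) ⊆ Σ⁺ ∪ {0}`. -/
def Adapted (G : KacMoodyAlgebra A g) (M : KacMoodyAlgebra B m) (φ : m →ₗ⁅ℂ⁆ g)
    (hle : M.H.map φ.toLinearMap ≤ G.H) : Prop :=
  ∀ χ ∈ posRoots G, resD G M φ hle χ = 0 ∨ resD G M φ hle χ ∈ posRoots M

/-- The set `J = {i ∈ I | ρ_a(α_i) = 0}`. -/
def Jof (G : KacMoodyAlgebra A g) (M : KacMoodyAlgebra B m) (φ : m →ₗ⁅ℂ⁆ g)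
    (hle : M.H.map φ.toLinearMap ≤ G.H) : Set I :=
  {i | resRoot G M φ hle i = 0}

/-- The set `Γ_s = {i ∈ I' | ρ_a(α_i) = γ_s}`. -/
def GammaOf (G : KacMoodyAlgebra A g) (M : KacMoodyAlgebra B m) (φ : m →ₗ⁅ℂ⁆ g)
    (hle : M.H.map φ.toLinearMap ≤ G.H) (s : S) : Set I :=
  {i | resRoot G M φ hle i = M.root s}

/-- The set `I'_re = {i ∈ I' | ρ_a(α_i) ∈ Π_a}`. -/
def IpRe (G : KacMoodyAlgebra A g) (M : KacMoodyAlgebra B m) (φ : m →ₗ⁅ℂ⁆ g)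
    (hle : M.H.map φ.toLinearMap ≤ G.H) : Set I :=
  {i | ∃ s : S, resRoot G M φ hle i = M.root s}

/-- The set `I'_im = {i ∈ I | ρ_a(α_i) ∉ Π_a ∪ {0}}`. -/
def IpIm (G : KacMoodyAlgebra A g) (M : KacMoodyAlgebra B m) (φ : m →ₗ⁅ℂ⁆ g)
    (hle : M.H.map φ.toLinearMap ≤ G.H) : Set I :=
  {i | resRoot G M φ hle i ≠ 0 ∧ ∀ s : S, resRoot G M φ hle i ≠ M.root s}

/-- The set `I_re` : union of the components `I_k`, `k ∈ I'_re`. -/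
def IreOf (G : KacMoodyAlgebra A g) (M : KacMoodyAlgebra B m) (φ : m →ₗ⁅ℂ⁆ g)
    (hle : M.H.map φ.toLinearMap ≤ G.H) : Set I :=
  {i | ∃ k ∈ IpRe G M φ hle, i ∈ cmpnt A (Jof G M φ hle ∪ {k}) k}

/-- `g` is maximally finitely graded: finitely graded, with `a ⊆ h`, the root basis of the
grading subalgebra adapted, and the corresponding sets `J` and `I'_im` empty. -/
def MaxFinGrading (G : KacMoodyAlgebra A g) (M : KacMoodyAlgebra B m) (φ : m →ₗ⁅ℂ⁆ g) : Prop :=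
  IsFinGrading M φ ∧ ∃ hle : M.H.map φ.toLinearMap ≤ G.H,
    Adapted G M φ hle ∧ Jof G M φ hle = ∅ ∧ IpIm G M φ hle = ∅

end Grading

/-- `(π, πv)` is a root basis (with generalized Cartan matrix `B`) of the root system `Rts`. -/
def IsRootBasis {V : Type*} [AddCommGroup V] [Module ℂ V] {S : Type*} [Fintype S]
    (B : Matrix S S ℤ) (Rts : Set (Module.Dual ℂ V)) (π : S → Module.Dual ℂ V)
    (πv : S → V) : Prop :=
  LinearIndependent ℂ π ∧ LinearIndependent ℂ πv ∧
  (∀ s t, π t (πv s) = (B s t : ℂ)) ∧ (∀ s, π s ∈ Rts) ∧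
  ∀ χ ∈ Rts, (∃ c : S → ℕ, χ = ∑ s, (c s : ℂ) • π s) ∨
    (∃ c : S → ℕ, χ = -∑ s, (c s : ℂ) • π s)

/-- `Bf` is a nondegenerate invariant symmetric bilinear form on `g`. -/
def InvariantForm (Bf : g →ₗ[ℂ] g →ₗ[ℂ] ℂ) : Prop :=
  (∀ x y, Bf x y = Bf y x) ∧ (∀ x y z, Bf ⁅x, y⁆ z = Bf x ⁅y, z⁆) ∧
  ∀ x, (∀ y, Bf x y = 0) → x = 0

/-- `Bf` is "the" invariant bilinear form of the Kac-Moody algebra `G` : nondegenerate,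
invariant, symmetric, with `(α_i∨, α_i∨)` a positive rational for all `i`. -/
def NormalizedInvForm (G : KacMoodyAlgebra A g) (Bf : g →ₗ[ℂ] g →ₗ[ℂ] ℂ) : Prop :=
  InvariantForm Bf ∧ ∀ i : I, ∃ q : ℚ, 0 < q ∧ Bf ((G.coroot i : g)) ((G.coroot i : g)) = (q : ℂ)

/-- `(e', f')` is a system of Chevalley generators for `G` (with the given Cartan subalgebra,
simple roots and coroots). -/
def IsChevalleyGens (G : KacMoodyAlgebra A g) (e' f' : I → g) : Prop :=
  (∀ (x : G.H) (i : I), ⁅(x : g), e' i⁆ = G.root i x • e' i) ∧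
  (∀ (x : G.H) (i : I), ⁅(x : g), f' i⁆ = -(G.root i x) • f' i) ∧
  (∀ i j, ⁅e' i, f' j⁆ = if j = i then ((G.coroot i : g)) else 0) ∧
  (∀ i j, i ≠ j → ((LieAlgebra.ad ℂ g (e' i)) ^ (1 - A i j).toNat) (e' j) = 0) ∧
  (∀ i j, i ≠ j → ((LieAlgebra.ad ℂ g (f' i)) ^ (1 - A i j).toNat) (f' j) = 0) ∧
  LieSubalgebra.lieSpan ℂ g ((G.H : Set g) ∪ Set.range e' ∪ Set.range f') = ⊤


/-- The subalgebra `g(I_re)` of `g` generated by `h_{I_re}` and the `e_i, f_i`, `i ∈ I_re`. -/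
def gIre (G : KacMoodyAlgebra A g) (Ire : Set I) (hIre : Submodule ℂ g) : LieSubalgebra ℂ g :=
  LieSubalgebra.lieSpan ℂ g
    ((hIre : Set g) ∪ {x | ∃ i ∈ Ire, x = G.e i} ∪ {x | ∃ i ∈ Ire, x = G.f i})

/-- `GI` is "the" Kac-Moody structure on `g(I_re)` : its Cartan subalgebra is `h_{I_re}`,
its coroots and Chevalley generators are the `α_i∨, e_i, f_i` of `g`, for `i ∈ I_re`. -/
def IsAssocKMIre (G : KacMoodyAlgebra A g) (Ire : Set I) (hIre : Submodule ℂ g)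
    {A'' : Matrix ↥Ire ↥Ire ℤ} (GI : KacMoodyAlgebra A'' ↥(gIre G Ire hIre)) : Prop :=
  GI.H.map (gIre G Ire hIre).toSubmodule.subtype = hIre ∧
  (∀ i, ((GI.coroot i : ↥(gIre G Ire hIre)) : g) = ((G.coroot i.1 : ↥G.H) : g)) ∧
  (∀ i, ((GI.e i : ↥(gIre G Ire hIre)) : g) = G.e i.1) ∧
  (∀ i, ((GI.f i : ↥(gIre G Ire hIre)) : g) = G.f i.1)

/-! ### Admissible quotients and maximal gradations -/

/-- `ρ : I → S` is an admissible quotient map for `A` : fibers are totally disconnected (MG1)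
and the column sums over a fiber are constant along fibers (MG2). -/
def AdmissibleQuotient {I S : Type*} (A : Matrix I I ℤ) (ρ : I → S) : Prop :=
  Function.Surjective ρ ∧
  (∀ k l, k ≠ l → ρ k = ρ l → A k l = 0) ∧
  ∀ s t : S, s ≠ t → ∀ j j', ρ j = t → ρ j' = t →
    ∑ᶠ i ∈ {i | ρ i = s}, A i j = ∑ᶠ i ∈ {i | ρ i = s}, A i j'

section Quotient

variable {S : Type*} [Fintype S] [DecidableEq S]

/-- `γ_s∨ = ∑_{k ∈ Γ_s} α_k∨`. -/
def gammaV (G : KacMoodyAlgebra A g) (ρ : I → S) (s : S) : G.H :=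
  ∑ᶠ k ∈ {k | ρ k = s}, G.coroot k

/-- `X̄_s = ∑_{k ∈ Γ_s} e_k`. -/
def Xbar (G : KacMoodyAlgebra A g) (ρ : I → S) (s : S) : g :=
  ∑ᶠ k ∈ {k | ρ k = s}, G.e k

/-- `Ȳ_s = ∑_{k ∈ Γ_s} f_k`. -/
def Ybar (G : KacMoodyAlgebra A g) (ρ : I → S) (s : S) : g :=
  ∑ᶠ k ∈ {k | ρ k = s}, G.f k

/-- The subalgebra `g^ρ` generated by `a` and the `X̄_s, Ȳ_s`. -/
def gRho (G : KacMoodyAlgebra A g) (ρ : I → S) (a : Submodule ℂ G.H) : LieSubalgebra ℂ g :=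
  LieSubalgebra.lieSpan ℂ g
    (((a.map G.H.subtype : Submodule ℂ g) : Set g) ∪ Set.range (Xbar G ρ) ∪
      Set.range (Ybar G ρ))

/-- `Gρ` is "the" Kac-Moody structure on `g^ρ` : its Cartan subalgebra is `a`, its coroots
are the `γ_s∨` and its Chevalley generators are the `X̄_s, Ȳ_s`. -/
def IsAssocKMrho (G : KacMoodyAlgebra A g) (ρ : I → S) (a : Submodule ℂ G.H)
    {Abar : Matrix S S ℤ} (Gρ : KacMoodyAlgebra Abar ↥(gRho G ρ a)) : Prop :=
  Gρ.H.map (gRho G ρ a).toSubmodule.subtype = a.map G.H.subtype ∧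
  (∀ s, ((Gρ.coroot s : ↥(gRho G ρ a)) : g) = ((gammaV G ρ s : ↥G.H) : g)) ∧
  (∀ s, ((Gρ.e s : ↥(gRho G ρ a)) : g) = Xbar G ρ s) ∧
  (∀ s, ((Gρ.f s : ↥(gRho G ρ a)) : g) = Ybar G ρ s)

end Quotient

end KMG

namespace KMG

open Module

/-! ### Independence of weight spaces -/

section WeightSpaces

variable {g : Type*} [LieRing g] [LieAlgebra ℂ g] {V : Type*} [AddCommGroup V] [Module ℂ V]

lemma iSupIndep_wtSpaceι (ι : V →ₗ[ℂ] g) (hι : ∀ v w, ⁅ι v, ι w⁆ = 0) :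
    iSupIndep (wtSpaceι ι) := by
  have h := Module.End.independent_iInf_maxGenEigenspace_of_forall_mapsTo
    (fun v : V => LieAlgebra.ad ℂ g (ι v)) fun v w c =>
      Module.End.mapsTo_maxGenEigenspace_of_comm
        (show _ * _ = _ * _ by
          ext x
          simp only [Module.End.mul_apply, LieAlgebra.ad_apply]
          rw [leibniz_lie, hι, zero_lie, zero_add]) c
  refine (h.comp (f := fun χ : Dual ℂ V => (χ : V → ℂ)) DFunLike.coe_injective).mono
    fun χ x hx => ?_
  simp only [Function.comp_apply, Submodule.mem_iInf]
  exact fun v => (Module.End.genEigenspace _ _).mono le_top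
    (Module.End.mem_eigenspace_iff.mpr (hx v))

lemma wtSpaceι_eq_iSup {J : Type*} (ι : V →ₗ[ℂ] g) (hι : ∀ v w, ⁅ι v, ι w⁆ = 0)
    (U : J → Submodule ℂ g) (wt : J → Dual ℂ V) (hU : ∀ j, U j ≤ wtSpaceι ι (wt j))
    (htop : ⨆ j, U j = ⊤) (χ : Dual ℂ V) :
    wtSpaceι ι χ = ⨆ j : {j // wt j = χ}, U j := by
  set X := ⨆ j : {j // wt j = χ}, U j with hX
  set Y := ⨆ j : {j // wt j ≠ χ}, U j with hY
  have hXle : X ≤ wtSpaceι ι χ := iSup_le fun j => (hU j.1).trans_eq (by rw [j.2])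
  have hYle : Y ≤ ⨆ (ψ) (_ : ψ ≠ χ), wtSpaceι ι ψ :=
    iSup_le fun j => (hU j.1).trans (le_iSup₂_of_le (wt j.1) j.2 le_rfl)
  have hdisj : Disjoint (wtSpaceι ι χ) Y := (iSupIndep_wtSpaceι ι hι χ).mono_right hYle
  have hXY : X ⊔ Y = ⊤ := by
    refine top_unique (htop.symm.trans_le (iSup_le fun j => ?_))
    by_cases hj : wt j = χ
    · exact le_sup_of_le_left (le_iSup_of_le (⟨j, hj⟩ : {j // wt j = χ}) le_rfl)
    · exact le_sup_of_le_right (le_iSup_of_le (⟨j, hj⟩ : {j // wt j ≠ χ}) le_rfl)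
  refine le_antisymm ?_ hXle
  calc wtSpaceι ι χ = (X ⊔ Y) ⊓ wtSpaceι ι χ := by rw [hXY, top_inf_eq]
    _ = X ⊔ Y ⊓ wtSpaceι ι χ := (sup_inf_assoc_of_le Y hXle)
    _ = X := by rw [inf_comm, hdisj.eq_bot, sup_bot_eq]
    _ ≤ X := le_rfl

lemma lie_mem_wtSpaceι {ι : V →ₗ[ℂ] g} {χ ψ : Dual ℂ V} {x y : g} (hx : x ∈ wtSpaceι ι χ)
    (hy : y ∈ wtSpaceι ι ψ) : ⁅x, y⁆ ∈ wtSpaceι ι (χ + ψ) := fun v => by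
  rw [leibniz_lie, hx v, hy v, smul_lie, lie_smul, LinearMap.add_apply, add_smul]

lemma ad_pow_mem_wtSpaceι {ι : V →ₗ[ℂ] g} {χ ψ : Dual ℂ V} {x y : g} (hx : x ∈ wtSpaceι ι χ)
    (hy : y ∈ wtSpaceι ι ψ) (n : ℕ) :
    ((LieModule.toEnd ℂ g g x) ^ n) y ∈ wtSpaceι ι (ψ + n • χ) := by
  induction n with
  | zero => simpa using hy
  | succ n ih =>
    rw [pow_succ', Module.End.mul_apply, LieModule.toEnd_apply_apply, succ_nsmul, add_left_comm,
      ← add_assoc, add_assoc, add_comm]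
    convert lie_mem_wtSpaceι hx ih using 2
    abel

end WeightSpaces

/-! ### Words in the Chevalley generators -/

section Words

variable {I : Type*} [Fintype I] [DecidableEq I] {A : Matrix I I ℤ}
variable {g : Type*} [LieRing g] [LieAlgebra ℂ g]

/-- The Kac-Moody structure with the roles of the positive and negative roots exchanged. -/
def KacMoodyAlgebra.op (G : KacMoodyAlgebra A g) : KacMoodyAlgebra A g where
  H := G.H
  root i := -G.root i
  coroot i := -G.coroot i
  e := G.f
  f := G.e
  findimH := G.findimH
  finrankH := G.finrankH
  indepRoot := by simpa [Pi.smul_def'] using G.indepRoot.units_smul fun _ => (-1 : ℂˣ)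
  indepCoroot := by simpa [Pi.smul_def'] using G.indepCoroot.units_smul fun _ => (-1 : ℂˣ)
  pairing i j := by simp [G.pairing]
  abelian := G.abelian
  lie_e x i := by simpa using G.lie_f x i
  lie_f x i := by simpa using G.lie_e x i
  e_f i j := by
    rw [← lie_skew, G.e_f]
    by_cases h : i = j
    · subst h; simp
    · simp [h, Ne.symm h]
  serre_e := G.serre_f
  serre_f := G.serre_e
  generates := by
    rw [Set.union_assoc, Set.union_comm (Set.range G.f), ← Set.union_assoc, G.generates]
  weight_decomp := G.weight_decomp
  zero_weight := G.zero_weight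

/-- The right-normed bracket `[e_{j₁}, [e_{j₂}, …, [e_{jₙ}, e_i]]]`. -/
def bracketWord (e : I → g) : List I → I → g
  | [], i => e i
  | j :: w, i => ⁅e j, bracketWord e w i⁆

/-- The number of occurrences of each letter in a nonempty word. -/
def wordContent : List I → I → I → ℤ
  | [], i => Pi.single i 1
  | j :: w, i => Pi.single j 1 + wordContent w i

omit [Fintype I] in
lemma wordContent_nonneg (w : List I) (i : I) : 0 ≤ wordContent w i := by
  induction w with
  | nil => exact Pi.single_nonneg.mpr zero_le_one
  | cons j w ih => exact add_nonneg (Pi.single_nonneg.mpr zero_le_one) ih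

lemma sum_wordContent (w : List I) (i : I) : ∑ k, wordContent w i k = w.length + 1 := by
  induction w with
  | nil => simp [wordContent]
  | cons j w ih => simp [wordContent, Finset.sum_add_distrib, ih]; ring

lemma wordContent_ne_zero (w : List I) (i : I) : wordContent w i ≠ 0 := fun h => by
  have := sum_wordContent w i
  simp [h] at this
  omega

/-- The integral combination of simple roots with given coefficients. -/
def rootComb (G : KacMoodyAlgebra A g) : (I → ℤ) →ₗ[ℤ] Dual ℂ G.H :=
  Fintype.linearCombination ℤ G.root

lemma rootComb_apply (G : KacMoodyAlgebra A g) (c : I → ℤ) :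
    rootComb G c = ∑ k, c k • G.root k := rfl

@[simp] lemma rootComb_single (G : KacMoodyAlgebra A g) (i : I) (n : ℤ) :
    rootComb G (Pi.single i n) = n • G.root i :=
  Fintype.linearCombination_apply_single ..

lemma rootComb_injective (G : KacMoodyAlgebra A g) : Function.Injective (rootComb G) :=
  linearIndependent_iff_injective_fintypeLinearCombination.mp
    (G.indepRoot.restrict_scalars (by
      simpa using (Int.cast_injective : Function.Injective (Int.cast : ℤ → ℂ))))

lemma rootComb_op (G : KacMoodyAlgebra A g) (c : I → ℤ) : rootComb G.op c = rootComb G (-c) := by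
  simp only [rootComb_apply, Pi.neg_apply, neg_smul]
  exact Finset.sum_congr rfl fun k _ => smul_neg _ _

lemma rootComb_coroot (G : KacMoodyAlgebra A g) (c : I → ℤ) (k : I) :
    rootComb G c (G.coroot k) = ((∑ i, c i * A k i : ℤ) : ℂ) := by
  simp [rootComb_apply, G.pairing, LinearMap.sum_apply]

lemma e_mem_wtSpaceι (G : KacMoodyAlgebra A g) (i : I) :
    G.e i ∈ wtSpaceι G.H.subtype (G.root i) := fun v => G.lie_e v i

lemma f_mem_wtSpaceι (G : KacMoodyAlgebra A g) (i : I) :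
    G.f i ∈ wtSpaceι G.H.subtype (-G.root i) := fun v => G.lie_f v i

lemma bracketWord_e_mem_wtSpaceι (G : KacMoodyAlgebra A g) (w : List I) (i : I) :
    bracketWord G.e w i ∈ wtSpaceι G.H.subtype (rootComb G (wordContent w i)) := by
  induction w with
  | nil => simpa [wordContent, bracketWord] using e_mem_wtSpaceι G i
  | cons j w ih =>
    rw [wordContent, map_add, rootComb_single, one_smul]
    exact lie_mem_wtSpaceι (e_mem_wtSpaceι G j) ih

lemma bracketWord_f_mem_wtSpaceι (G : KacMoodyAlgebra A g) (w : List I) (i : I) :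
    bracketWord G.f w i ∈ wtSpaceι G.H.subtype (rootComb G (-wordContent w i)) := by
  rw [← rootComb_op]
  exact bracketWord_e_mem_wtSpaceι G.op w i

/-- The span of all right-normed brackets of the `e i`. -/
def wordSpan (e : I → g) : Submodule ℂ g :=
  Submodule.span ℂ (Set.range fun p : List I × I => bracketWord e p.1 p.2)

omit [Fintype I] [DecidableEq I] in
lemma bracketWord_mem_wordSpan (e : I → g) (w : List I) (i : I) :
    bracketWord e w i ∈ wordSpan e := Submodule.subset_span ⟨(w, i), rfl⟩

omit [Fintype I] [DecidableEq I] in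
lemma lie_mem_of_mem_wordSpan {e : I → g} {y : g} {T : Submodule ℂ g}
    (h : ∀ w i, ⁅y, bracketWord e w i⁆ ∈ T) {x : g} (hx : x ∈ wordSpan e) : ⁅y, x⁆ ∈ T := by
  have : wordSpan e ≤ T.comap (LieAlgebra.ad ℂ g y) := by
    refine Submodule.span_le.mpr ?_
    rintro _ ⟨p, rfl⟩
    exact h p.1 p.2
  exact this hx

omit [Fintype I] [DecidableEq I] in
lemma lie_gen_mem_wordSpan (e : I → g) (j : I) {x : g} (hx : x ∈ wordSpan e) :
    ⁅e j, x⁆ ∈ wordSpan e :=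
  lie_mem_of_mem_wordSpan (fun w i => bracketWord_mem_wordSpan e (j :: w) i) hx

lemma lie_H_mem_wordSpan (G : KacMoodyAlgebra A g) (h : G.H) {x : g} (hx : x ∈ wordSpan G.e) :
    ⁅(h : g), x⁆ ∈ wordSpan G.e := by
  refine lie_mem_of_mem_wordSpan (fun w i => ?_) hx
  rw [show ⁅(h : g), bracketWord G.e w i⁆ = _ from bracketWord_e_mem_wtSpaceι G w i h]
  exact Submodule.smul_mem _ _ (bracketWord_mem_wordSpan G.e w i)

lemma lie_f_mem_sup_wordSpan (G : KacMoodyAlgebra A g) (j : I) {x : g}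
    (hx : x ∈ wordSpan G.e) : ⁅G.f j, x⁆ ∈ G.H ⊔ wordSpan G.e := by
  have hco : ∀ k, ⁅G.f j, G.e k⁆ ∈ G.H := fun k => by
    rw [← lie_skew, G.e_f]
    split_ifs
    · exact neg_mem (G.coroot k).2
    · simp
  refine lie_mem_of_mem_wordSpan (fun w i => ?_) hx
  induction w with
  | nil => exact Submodule.mem_sup_left (hco i)
  | cons k w ih =>
    rw [bracketWord, leibniz_lie]
    refine add_mem (Submodule.mem_sup_right
      (lie_H_mem_wordSpan G ⟨_, hco k⟩ (bracketWord_mem_wordSpan G.e w i))) ?_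
    obtain ⟨y, hy, z, hz, hyz⟩ := Submodule.mem_sup.mp ih
    rw [← hyz, lie_add]
    refine Submodule.mem_sup_right (add_mem ?_ (lie_gen_mem_wordSpan _ _ hz))
    rw [← lie_skew, G.lie_e ⟨y, hy⟩ k]
    exact neg_mem (Submodule.smul_mem _ _ (bracketWord_mem_wordSpan G.e [] k))

lemma lie_e_mem_sup (G : KacMoodyAlgebra A g) (j : I) {x : g}
    (hx : x ∈ G.H ⊔ wordSpan G.e ⊔ wordSpan G.f) :
    ⁅G.e j, x⁆ ∈ G.H ⊔ wordSpan G.e ⊔ wordSpan G.f := by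
  obtain ⟨y, hy, z, hz, rfl⟩ := Submodule.mem_sup.mp hx
  obtain ⟨u, hu, v, hv, rfl⟩ := Submodule.mem_sup.mp hy
  rw [lie_add, lie_add]
  refine add_mem (Submodule.mem_sup_left (Submodule.mem_sup_right (add_mem ?_
    (lie_gen_mem_wordSpan _ _ hv)))) ?_
  · rw [← lie_skew, G.lie_e ⟨u, hu⟩ j]
    exact neg_mem (Submodule.smul_mem _ _ (bracketWord_mem_wordSpan G.e [] j))
  · exact (sup_le_sup_right le_sup_left _ : G.H ⊔ wordSpan G.f ≤ _)
      (lie_f_mem_sup_wordSpan G.op j hz)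

theorem sup_wordSpan_eq_top (G : KacMoodyAlgebra A g) :
    G.H ⊔ wordSpan G.e ⊔ wordSpan G.f = ⊤ := by
  set T := G.H ⊔ wordSpan G.e ⊔ wordSpan G.f with hT
  have hswap : T = G.op.H ⊔ wordSpan G.op.e ⊔ wordSpan G.op.f := sup_right_comm _ _ _
  have hgen : ((G.H : Set g) ∪ Set.range G.e ∪ Set.range G.f) ⊆ T := by
    rintro x ((hx | ⟨i, rfl⟩) | ⟨i, rfl⟩)
    · exact Submodule.mem_sup_left (Submodule.mem_sup_left hx)
    · exact Submodule.mem_sup_left (Submodule.mem_sup_right (bracketWord_mem_wordSpan G.e [] i))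
    · exact Submodule.mem_sup_right (bracketWord_mem_wordSpan G.f [] i)
  have hideal : ∀ y : g, ∀ x ∈ T, ⁅y, x⁆ ∈ T := fun y => by
    have hy : y ∈ LieSubalgebra.lieSpan ℂ g
        ((G.H : Set g) ∪ Set.range G.e ∪ Set.range G.f) := by simp [G.generates]
    induction hy using LieSubalgebra.lieSpan_induction with
    | mem y hy =>
      intro x hx
      rcases hy with (hy | ⟨i, rfl⟩) | ⟨i, rfl⟩
      · obtain ⟨u, hu, z, hz, rfl⟩ := Submodule.mem_sup.mp hx
        obtain ⟨t, ht, v, hv, rfl⟩ := Submodule.mem_sup.mp hu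
        rw [lie_add, lie_add, G.abelian ⟨y, hy⟩ ⟨t, ht⟩, zero_add]
        exact add_mem
          (Submodule.mem_sup_left (Submodule.mem_sup_right (lie_H_mem_wordSpan G ⟨y, hy⟩ hv)))
          (Submodule.mem_sup_right (lie_H_mem_wordSpan G.op ⟨y, hy⟩ hz))
      · exact lie_e_mem_sup G i hx
      · rw [hswap] at hx ⊢
        exact lie_e_mem_sup G.op i hx
    | zero => intro x _; simp
    | add y z _ _ hy hz => intro x hx; rw [add_lie]; exact add_mem (hy x hx) (hz x hx)
    | smul c y _ hy => intro x hx; rw [smul_lie]; exact Submodule.smul_mem _ _ (hy x hx)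
    | lie y z _ _ hy hz =>
      intro x hx
      rw [lie_lie]
      exact sub_mem (hy _ (hz x hx)) (hz _ (hy x hx))
  let L : LieSubalgebra ℂ g := { T with lie_mem' := fun _ hy => hideal _ _ hy }
  have hL : (⊤ : LieSubalgebra ℂ g) ≤ L := by
    rw [← G.generates]
    exact LieSubalgebra.lieSpan_le.mpr hgen
  exact top_unique fun x _ => hL (LieSubalgebra.mem_top x)

/-- The pieces of the triangular decomposition: the Cartan subalgebra, and the lines spanned by
words in the `e i`, respectively the `f i`. -/
def triSpace (G : KacMoodyAlgebra A g) : Option ((List I × I) ⊕ (List I × I)) → Submodule ℂ g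
  | none => G.H
  | some (.inl p) => ℂ ∙ bracketWord G.e p.1 p.2
  | some (.inr p) => ℂ ∙ bracketWord G.f p.1 p.2

/-- The root lattice coordinates of the weight of `triSpace`. -/
def triContent : Option ((List I × I) ⊕ (List I × I)) → I → ℤ
  | none => 0
  | some (.inl p) => wordContent p.1 p.2
  | some (.inr p) => -wordContent p.1 p.2

lemma triSpace_le (G : KacMoodyAlgebra A g) (j) :
    triSpace G j ≤ wtSpaceι G.H.subtype (rootComb G (triContent j)) := by
  rcases j with _ | p | p
  · exact fun x hx v => by simpa [triContent] using G.abelian v ⟨x, hx⟩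
  · exact (Submodule.span_singleton_le_iff_mem _ _).mpr (bracketWord_e_mem_wtSpaceι G p.1 p.2)
  · exact (Submodule.span_singleton_le_iff_mem _ _).mpr (bracketWord_f_mem_wtSpaceι G p.1 p.2)

lemma iSup_triSpace (G : KacMoodyAlgebra A g) : ⨆ j, triSpace G j = ⊤ := by
  refine top_unique ((sup_wordSpan_eq_top G).symm.trans_le (sup_le (sup_le ?_ ?_) ?_))
  · exact le_iSup (triSpace G) none
  · refine Submodule.span_le.mpr ?_
    rintro _ ⟨p, rfl⟩
    exact le_iSup (triSpace G) (some (.inl p)) (Submodule.mem_span_singleton_self _)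
  · refine Submodule.span_le.mpr ?_
    rintro _ ⟨p, rfl⟩
    exact le_iSup (triSpace G) (some (.inr p)) (Submodule.mem_span_singleton_self _)

instance (G : KacMoodyAlgebra A g) (j) : FiniteDimensional ℂ (triSpace G j) := by
  have := G.findimH
  rcases j with _ | p | p <;> unfold triSpace <;> infer_instance

lemma exists_tri_of_wtSpaceι_ne_bot (G : KacMoodyAlgebra A g) {χ : Dual ℂ G.H}
    (h : wtSpaceι G.H.subtype χ ≠ ⊥) : ∃ j, rootComb G (triContent j) = χ ∧ triSpace G j ≠ ⊥ := by
  rw [wtSpaceι_eq_iSup G.H.subtype G.abelian (triSpace G) _ (triSpace_le G) (iSup_triSpace G),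
    ne_eq, iSup_eq_bot, not_forall] at h
  obtain ⟨j, hj⟩ := h
  exact ⟨j.1, j.2, hj⟩

lemma nonneg_or_nonpos_of_wtSpaceι_ne_bot (G : KacMoodyAlgebra A g) {c : I → ℤ}
    (h : wtSpaceι G.H.subtype (rootComb G c) ≠ ⊥) : 0 ≤ c ∨ c ≤ 0 := by
  obtain ⟨j, hj, -⟩ := exists_tri_of_wtSpaceι_ne_bot G h
  obtain rfl := rootComb_injective G hj
  rcases j with _ | p | p
  · exact Or.inl le_rfl
  · exact Or.inl (wordContent_nonneg _ _)
  · exact Or.inr (neg_nonpos.mpr (wordContent_nonneg _ _))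

lemma exists_word_of_wtSpaceι_ne_bot (G : KacMoodyAlgebra A g) {c : I → ℤ} (hc : 0 ≤ c)
    (hc0 : c ≠ 0) (h : wtSpaceι G.H.subtype (rootComb G c) ≠ ⊥) :
    ∃ w i, wordContent w i = c ∧ bracketWord G.e w i ≠ 0 := by
  obtain ⟨j, hj, hne⟩ := exists_tri_of_wtSpaceι_ne_bot G h
  obtain rfl := rootComb_injective G hj
  rcases j with _ | p | p
  · exact absurd rfl hc0
  · refine ⟨p.1, p.2, rfl, fun h0 => hne ?_⟩
    simp [triSpace, h0]
  · exact absurd (le_antisymm hc (neg_nonpos.mpr (wordContent_nonneg _ _))).symm hc0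

lemma wtSpaceι_ne_bot_of_mem {V : Type*} [AddCommGroup V] [Module ℂ V] {ι : V →ₗ[ℂ] g}
    {χ : Dual ℂ V} {x : g} (hx : x ∈ wtSpaceι ι χ) (hx0 : x ≠ 0) : wtSpaceι ι χ ≠ ⊥ :=
  fun h => hx0 (by rwa [h, Submodule.mem_bot] at hx)

lemma e_ne_zero (G : KacMoodyAlgebra A g) (i : I) : G.e i ≠ 0 := fun h => by
  have := G.e_f i i
  rw [h, zero_lie, if_pos rfl, eq_comm, ZeroMemClass.coe_eq_zero] at this
  exact G.indepCoroot.ne_zero i this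

lemma eq_nil_of_bracketWord_ne_zero (G : KacMoodyAlgebra A g) {T : Set I}
    (hT : ∀ k ∈ T, ∀ l ∈ T, k ≠ l → A k l = 0) {w : List I} {i : I}
    (hw : bracketWord G.e w i ≠ 0) (hsupp : ∀ k, wordContent w i k ≠ 0 → k ∈ T) : w = [] := by
  induction w with
  | nil => rfl
  | cons j w ih =>
    exfalso
    have hw' : bracketWord G.e w i ≠ 0 := fun h => hw (by rw [bracketWord, h, lie_zero])
    have hpos : ∀ k, wordContent w i k ≠ 0 → wordContent (j :: w) i k ≠ 0 := fun k hk => by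
      have h1 := wordContent_nonneg w i k
      have h2 : (0 : I → ℤ) ≤ Pi.single j 1 := Pi.single_nonneg.mpr zero_le_one
      have h3 := h2 k
      simp only [wordContent, Pi.add_apply, Pi.zero_apply] at *
      omega
    obtain rfl := ih hw' fun k hk => hsupp k (hpos k hk)
    have hi : i ∈ T := hsupp i (hpos i (by simp [wordContent]))
    have hj : j ∈ T := hsupp j (by
      have := wordContent_nonneg [] i j
      simp only [wordContent, Pi.add_apply, Pi.zero_apply, Pi.single_eq_same] at *
      omega)
    by_cases hji : j = i
    · subst hji
      exact hw (lie_self _)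
    · apply hw
      simpa [bracketWord, hT j hj i hi hji] using G.serre_e j i hji

end Words

/-! ### Root strings -/

section Strings

variable {I : Type*} [Fintype I] [DecidableEq I] {A : Matrix I I ℤ}
variable {g : Type*} [LieRing g] [LieAlgebra ℂ g]

lemma engel_e_eq_top (G : KacMoodyAlgebra A g) (i : I) :
    LieSubalgebra.engel ℂ (G.e i) = ⊤ := by
  have hH : ∀ x ∈ G.H, x ∈ LieSubalgebra.engel ℂ (G.e i) := fun x hx => by
    refine (LieSubalgebra.mem_engel_iff ..).mpr ⟨2, ?_⟩
    rw [pow_two, Module.End.mul_apply, LieAlgebra.ad_apply, LieAlgebra.ad_apply, ← lie_skew (G.e i) x,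
      G.lie_e ⟨x, hx⟩ i]
    simp
  rw [eq_top_iff, ← G.generates, LieSubalgebra.lieSpan_le]
  rintro x ((hx | ⟨j, rfl⟩) | ⟨j, rfl⟩)
  · exact hH x hx
  · by_cases hij : i = j
    · exact hij ▸ LieSubalgebra.self_mem_engel ℂ _
    · exact (LieSubalgebra.mem_engel_iff ..).mpr ⟨_, G.serre_e i j hij⟩
  · have h : ⁅G.e i, G.f j⁆ ∈ LieSubalgebra.engel ℂ (G.e i) := by
      rw [G.e_f]
      split_ifs
      · exact hH _ (G.coroot i).2
      · exact zero_mem _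
    obtain ⟨n, hn⟩ := (LieSubalgebra.mem_engel_iff ..).mp h
    exact (LieSubalgebra.mem_engel_iff ..).mpr ⟨n + 1, by
      rwa [pow_succ, Module.End.mul_apply, LieAlgebra.ad_apply]⟩

lemma isSl2Triple (G : KacMoodyAlgebra A g) (hA : ∀ i, A i i = 2) (i : I) :
    IsSl2Triple (G.coroot i : g) (G.e i) (G.f i) where
  h_ne_zero := by simpa using G.indepCoroot.ne_zero i
  lie_e_f := by simp [G.e_f]
  lie_h_e_nsmul := by rw [G.lie_e, G.pairing, hA]; simp [two_smul]
  lie_h_f_nsmul := by rw [G.lie_f, G.pairing, hA]; simp [two_smul]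

/-- If `χ` is a weight with `⟨χ, α_i∨⟩ = -p ≤ 0`, so are `χ + k α_i`, `0 ≤ k ≤ p`. -/
lemma wtSpaceι_add_nsmul_ne_bot (G : KacMoodyAlgebra A g) (hA : ∀ i, A i i = 2) (i : I)
    {χ : Dual ℂ G.H} (hχ : wtSpaceι G.H.subtype χ ≠ ⊥) {p : ℕ}
    (hp : χ (G.coroot i) = -(p : ℂ)) {k : ℕ} (hk : k ≤ p) :
    wtSpaceι G.H.subtype (χ + k • G.root i) ≠ ⊥ := by
  obtain ⟨v, hv, hv0⟩ := (Submodule.ne_bot_iff _).mp hχ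
  have hnil : ∃ n, ((LieModule.toEnd ℂ g g (G.f i)) ^ n) v = 0 :=
    (LieSubalgebra.mem_engel_iff ..).mp
      ((engel_e_eq_top G.op i).symm ▸ LieSubalgebra.mem_top v : v ∈ LieSubalgebra.engel ℂ (G.f i))
  obtain ⟨j, hj, hj'⟩ := Nat.exists_not_and_succ_of_not_zero_of_exists (by simpa using hv0) hnil
  set w := ((LieModule.toEnd ℂ g g (G.f i)) ^ j) v with hw
  have hwt : w ∈ wtSpaceι G.H.subtype (χ + j • (-G.root i)) :=
    ad_pow_mem_wtSpaceι (f_mem_wtSpaceι G i) hv j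
  have hprim : (isSl2Triple G hA i).symm.HasPrimitiveVectorWith w ((p + 2 * j : ℕ) : ℂ) :=
    { ne_zero := hj
      lie_h := by
        have h := hwt (G.coroot i)
        simp only [Submodule.subtype_apply, LinearMap.add_apply, LinearMap.smul_apply,
          LinearMap.neg_apply, G.pairing, hA, hp] at h
        rw [neg_lie, h, ← neg_smul]
        congr 1
        push_cast
        simp
        ring
      lie_e := by
        rw [pow_succ', Module.End.mul_apply, LieModule.toEnd_apply_apply] at hj'
        exact hj' }
  have hne := hprim.pow_toEnd_f_ne_zero_of_eq_nat rfl (i := j + k) (by omega)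
  refine wtSpaceι_ne_bot_of_mem (x := ((LieModule.toEnd ℂ g g (G.e i)) ^ (j + k)) w) ?_ hne
  convert ad_pow_mem_wtSpaceι (e_mem_wtSpaceι G i) hwt (j + k) using 2
  rw [add_smul, smul_neg]
  abel

/-- The set of weights is stable under simple reflections. -/
lemma wtSpaceι_reflect_ne_bot (G : KacMoodyAlgebra A g) (hA : ∀ i, A i i = 2) (i : I)
    {χ : Dual ℂ G.H} (hχ : wtSpaceι G.H.subtype χ ≠ ⊥) {n : ℤ} (hn : χ (G.coroot i) = n) :
    wtSpaceι G.H.subtype (χ - n • G.root i) ≠ ⊥ := by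
  obtain ⟨p, rfl | rfl⟩ := n.eq_nat_or_neg
  · have h := wtSpaceι_add_nsmul_ne_bot G.op hA i hχ (p := p) (k := p)
      ((map_neg χ (G.coroot i)).trans (by simp [hn])) le_rfl
    change wtSpaceι G.H.subtype (χ + p • (-G.root i)) ≠ ⊥ at h
    rwa [smul_neg, ← sub_eq_add_neg, ← natCast_zsmul] at h
  · convert wtSpaceι_add_nsmul_ne_bot G hA i hχ (p := p) (k := p) ?_ le_rfl using 2
    · simp
    · simp [hn]

end Strings

/-! ### Weights of quotients -/

lemma sum_linearMap_comp {ι U V W : Type*} [AddCommGroup U] [Module ℂ U] [AddCommGroup V]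
    [Module ℂ V] [AddCommGroup W] [Module ℂ W] (T : Finset ι) (f : ι → V →ₗ[ℂ] W)
    (κ : U →ₗ[ℂ] V) : (∑ i ∈ T, f i).comp κ = ∑ i ∈ T, (f i).comp κ :=
  map_sum (LinearMap.lcomp ℂ W κ) f T

section Quotient

variable {I : Type*} [Fintype I] [DecidableEq I] {A : Matrix I I ℤ}
variable {g : Type*} [LieRing g] [LieAlgebra ℂ g]
variable {S : Type*} [Fintype S] [DecidableEq S] {B : Matrix S S ℤ}
variable {m : Type*} [LieRing m] [LieAlgebra ℂ m]

/-- The linear map `κ` from the Cartan subalgebra of `M` to that of `G` identifies the simple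
roots along the fibers of `ρ`, and maps the simple coroots to sums over these fibers, which are
totally disconnected. -/
structure IsQuotientCartan (G : KacMoodyAlgebra A g) (M : KacMoodyAlgebra B m) (ρ : I → S)
    (κ : M.H →ₗ[ℂ] G.H) : Prop where
  diag : ∀ i, A i i = 2
  diag' : ∀ s, B s s = 2
  fiber : ∀ k l, k ≠ l → ρ k = ρ l → A k l = 0
  root : ∀ i, (G.root i).comp κ = M.root (ρ i)
  coroot : ∀ s, κ (M.coroot s) = ∑ k with ρ k = s, G.coroot k

/-- The sums of an integer vector over the fibers of `ρ`. -/
def fiberSum (ρ : I → S) (c : I → ℤ) (s : S) : ℤ := ∑ k with ρ k = s, c k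

omit [DecidableEq I] in
lemma sum_fiberSum (ρ : I → S) (c : I → ℤ) : ∑ s, fiberSum ρ c s = ∑ k, c k :=
  Finset.sum_fiberwise _ _ _

omit [DecidableEq I] in
lemma sum_pos_of_nonneg {c : I → ℤ} (hc : 0 ≤ c) (hc0 : c ≠ 0) : 0 < ∑ k, c k :=
  Finset.sum_pos' (fun k _ => hc k) <| by
    obtain ⟨k, hk⟩ := Function.ne_iff.mp hc0
    exact ⟨k, Finset.mem_univ k, lt_of_le_of_ne (hc k) hk.symm⟩

omit [DecidableEq I] in
lemma fiberSum_ne_zero (ρ : I → S) {c : I → ℤ} (hc : 0 ≤ c) (hc0 : c ≠ 0) :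
    fiberSum ρ c ≠ 0 := fun h => by
  have := sum_pos_of_nonneg hc hc0
  rw [← sum_fiberSum ρ, h] at this
  simp at this

variable {G : KacMoodyAlgebra A g} {M : KacMoodyAlgebra B m} {ρ : I → S} {κ : M.H →ₗ[ℂ] G.H}

namespace IsQuotientCartan

lemma op (Q : IsQuotientCartan G M ρ κ) : IsQuotientCartan G.op M.op ρ κ where
  diag := Q.diag
  diag' := Q.diag'
  fiber := Q.fiber
  root i := by
    change (-G.root i).comp κ = -M.root (ρ i)
    rw [LinearMap.neg_comp, Q.root]
  coroot s := by
    change κ (-M.coroot s) = ∑ k with ρ k = s, -G.coroot k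
    rw [map_neg, Q.coroot, Finset.sum_neg_distrib]

lemma rootComb_comp (Q : IsQuotientCartan G M ρ κ) (c : I → ℤ) :
    (rootComb G c).comp κ = rootComb M (fiberSum ρ c) := by
  simp only [rootComb_apply, fiberSum, Finset.sum_smul]
  rw [← Finset.sum_fiberwise Finset.univ ρ, sum_linearMap_comp]
  refine Finset.sum_congr rfl fun s _ => ?_
  rw [sum_linearMap_comp]
  refine Finset.sum_congr rfl fun k hk => ?_
  rw [LinearMap.smul_comp, Q.root, (Finset.mem_filter.mp hk).2]

lemma reflect_fiber_ne_bot (Q : IsQuotientCartan G M ρ κ) {c : I → ℤ}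
    (h : wtSpaceι G.H.subtype (rootComb G c) ≠ ⊥) {T : Finset I} {s : S}
    (hT : ∀ k ∈ T, ρ k = s) :
    wtSpaceι G.H.subtype (rootComb G (c - ∑ k ∈ T, Pi.single k (∑ i, c i * A k i))) ≠ ⊥ := by
  induction T using Finset.induction_on with
  | empty => simpa using h
  | insert l T hl ih =>
    have hval : rootComb G (c - ∑ k ∈ T, Pi.single k (∑ i, c i * A k i)) (G.coroot l) =
        ((∑ i, c i * A l i : ℤ) : ℂ) := by
      rw [map_sub, LinearMap.sub_apply, rootComb_coroot, sub_eq_self, map_sum,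
        LinearMap.sum_apply]
      refine Finset.sum_eq_zero fun k hk => ?_
      have hkl : A l k = 0 := Q.fiber l k (fun hlk => hl (hlk ▸ hk))
        ((hT l (Finset.mem_insert_self l T)).trans (hT k (Finset.mem_insert_of_mem hk)).symm)
      rw [rootComb_single, LinearMap.smul_apply, G.pairing, hkl, Int.cast_zero, smul_zero]
    have := wtSpaceι_reflect_ne_bot G Q.diag l
      (ih fun k hk => hT k (Finset.mem_insert_of_mem hk)) hval
    rw [← rootComb_single, ← map_sub, sub_sub, add_comm (∑ k ∈ T, _)] at this
    rwa [Finset.sum_insert hl]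

/-- Each reflection of `M` is induced by the product of the reflections of `G` along a fiber. -/
lemma exists_reflect (Q : IsQuotientCartan G M ρ κ) {c : I → ℤ}
    (h : wtSpaceι G.H.subtype (rootComb G c) ≠ ⊥) {s : S} {p : ℤ}
    (hp : (rootComb G c).comp κ (M.coroot s) = p) :
    ∃ c' : I → ℤ, wtSpaceι G.H.subtype (rootComb G c') ≠ ⊥ ∧ (∀ l, ρ l ≠ s → c' l = c l) ∧
      (rootComb G c').comp κ = (rootComb G c).comp κ - p • M.root s ∧
      ∑ k, c' k = ∑ k, c k - p := by
  have hp' : p = ∑ k with ρ k = s, ∑ i, c i * A k i := by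
    rw [LinearMap.comp_apply, Q.coroot, map_sum] at hp
    simp only [rootComb_coroot] at hp
    exact_mod_cast hp.symm
  refine ⟨_, Q.reflect_fiber_ne_bot h (T := {k | ρ k = s}) (s := s) (by simp), ?_, ?_, ?_⟩
  · intro l hl
    rw [Pi.sub_apply, Finset.sum_apply, Finset.sum_eq_zero, sub_zero]
    intro k hk
    refine Pi.single_eq_of_ne ?_ _
    rintro rfl
    exact hl (Finset.mem_filter.mp hk).2
  · rw [map_sub, map_sum, LinearMap.sub_comp, sum_linearMap_comp, hp', Finset.sum_smul]
    congr 1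
    refine Finset.sum_congr rfl fun k hk => ?_
    rw [rootComb_single, LinearMap.smul_comp, Q.root, (Finset.mem_filter.mp hk).2]
  · simp only [Pi.sub_apply, Finset.sum_sub_distrib, Finset.sum_apply]
    rw [Finset.sum_comm, hp']
    simp

/-- Positive roots of `G` restrict to weights of `M`. -/
theorem comp_ne_bot_of_nonneg (Q : IsQuotientCartan G M ρ κ) {c : I → ℤ} (hc : 0 ≤ c)
    (hc0 : c ≠ 0) (h : wtSpaceι G.H.subtype (rootComb G c) ≠ ⊥) :
    wtSpaceι M.H.subtype ((rootComb G c).comp κ) ≠ ⊥ := by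
  induction hn : (∑ k, c k).toNat using Nat.strong_induction_on generalizing c with
  | _ n ih =>
  subst hn
  have hpos := sum_pos_of_nonneg hc hc0
  obtain ⟨w, i, rfl, hne⟩ := exists_word_of_wtSpaceι_ne_bot G hc hc0 h
  rcases w with _ | ⟨j, w⟩
  · rw [wordContent, rootComb_single, one_smul, Q.root]
    exact wtSpaceι_ne_bot_of_mem (e_mem_wtSpaceι M (ρ i)) (e_ne_zero M _)
  have hne' : bracketWord G.e w i ≠ 0 := fun h0 => hne (by rw [bracketWord, h0, lie_zero])
  have hβ := ih _ (by
      rw [sum_wordContent, sum_wordContent, List.length_cons]; omega)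
    (wordContent_nonneg w i) (wordContent_ne_zero w i)
    (wtSpaceι_ne_bot_of_mem (bracketWord_e_mem_wtSpaceι G w i) hne') rfl
  set c := wordContent (j :: w) i with hcdef
  set s := ρ j with hs
  obtain ⟨p, hp⟩ : ∃ p : ℤ, (rootComb G c).comp κ (M.coroot s) = p :=
    ⟨_, by rw [Q.rootComb_comp, rootComb_coroot]⟩
  have hss : M.root s (M.coroot s) = 2 := by rw [M.pairing, Q.diag']; norm_num
  have hsplit : (rootComb G c).comp κ = (rootComb G (wordContent w i)).comp κ + M.root s := by
    rw [hcdef, wordContent, map_add, LinearMap.add_comp, rootComb_single, one_smul, Q.root,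
      add_comm]
  by_cases hp1 : p ≤ 1
  · have hval : (rootComb G (wordContent w i)).comp κ (M.coroot s) =
        -(((2 - p).toNat : ℕ) : ℂ) := by
      rw [hsplit, LinearMap.add_apply, hss] at hp
      have : (((2 - p).toNat : ℤ) : ℂ) = ((2 - p : ℤ) : ℂ) := by rw [Int.toNat_of_nonneg (by omega)]
      rw [Int.cast_natCast] at this
      rw [this, Int.cast_sub, ← hp]
      push_cast
      ring
    have := wtSpaceι_add_nsmul_ne_bot M Q.diag' s hβ hval (k := 1) (by omega)
    rwa [one_smul, ← hsplit] at this
  · obtain ⟨c', hc', hcl, hres, hsum⟩ := Q.exists_reflect h hp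
    obtain ⟨l, hl, hls⟩ : ∃ l, c l ≠ 0 ∧ ρ l ≠ s := by
      by_contra! hcon
      exact List.cons_ne_nil _ _ (eq_nil_of_bracketWord_ne_zero G (T := {k | ρ k = s})
        (fun k hk l hl hkl => Q.fiber k l hkl (hk.trans hl.symm)) hne hcon)
    have hlpos : 0 < c' l := by
      rw [hcl l hls]
      exact lt_of_le_of_ne (hc l) hl.symm
    have hc'nonneg : 0 ≤ c' := (nonneg_or_nonpos_of_wtSpaceι_ne_bot G hc').resolve_right
      fun hle => absurd (hle l) (not_le.mpr hlpos)
    have := ih _ (by rw [hsum]; omega) hc'nonneg (fun h0 => by simp [h0] at hlpos) hc' rfl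
    have := wtSpaceι_reflect_ne_bot M Q.diag' s this (n := -p) (by
      rw [hres, LinearMap.sub_apply, hp, LinearMap.smul_apply, hss, zsmul_eq_mul]
      push_cast
      ring)
    rwa [hres, neg_smul, sub_neg_eq_add, sub_add_cancel] at this

lemma rootComb_comp_ne_zero (Q : IsQuotientCartan G M ρ κ) {c : I → ℤ} (hc : 0 ≤ c)
    (hc0 : c ≠ 0) : (rootComb G c).comp κ ≠ 0 := by
  rw [Q.rootComb_comp, ← map_zero (rootComb M)]
  exact (rootComb_injective M).ne (fiberSum_ne_zero ρ hc hc0)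

lemma comp_mem_Delta_of_nonneg (Q : IsQuotientCartan G M ρ κ) {c : I → ℤ} (hc : 0 ≤ c)
    (hc0 : c ≠ 0) (h : wtSpaceι G.H.subtype (rootComb G c) ≠ ⊥) :
    (rootComb G c).comp κ ∈ Delta M :=
  ⟨Q.rootComb_comp_ne_zero hc hc0, Q.comp_ne_bot_of_nonneg hc hc0 h⟩

theorem comp_mem_Delta (Q : IsQuotientCartan G M ρ κ) {χ : Dual ℂ G.H} (hχ : χ ∈ Delta G) :
    χ.comp κ ∈ Delta M := by
  obtain ⟨j, rfl, -⟩ := exists_tri_of_wtSpaceι_ne_bot G hχ.2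
  have hj0 : triContent j ≠ 0 := fun h0 => hχ.1 (by rw [h0, map_zero])
  rcases nonneg_or_nonpos_of_wtSpaceι_ne_bot G hχ.2 with h | h
  · exact Q.comp_mem_Delta_of_nonneg h hj0 hχ.2
  · have := Q.op.comp_mem_Delta_of_nonneg (neg_nonneg.mpr h) (neg_ne_zero.mpr hj0)
      (by rw [rootComb_op, neg_neg]; exact hχ.2)
    rw [rootComb_op, neg_neg] at this
    exact this

lemma triSpace_le_wtSpaceι_comp {ι : M.H →ₗ[ℂ] g} (hι : ∀ x, ι x = κ x) (j) :
    triSpace G j ≤ wtSpaceι ι ((rootComb G (triContent j)).comp κ) := fun x hx v => by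
  rw [hι]
  exact triSpace_le G j hx (κ v)

lemma exists_tri_comp_eq {ι : M.H →ₗ[ℂ] g} (hι : ∀ x, ι x = κ x) {χ : Dual ℂ M.H}
    (h : wtSpaceι ι χ ≠ ⊥) :
    ∃ j, (rootComb G (triContent j)).comp κ = χ ∧ triSpace G j ≠ ⊥ := by
  rw [wtSpaceι_eq_iSup ι (fun v w => by rw [hι, hι, G.abelian]) (triSpace G) _
    (triSpace_le_wtSpaceι_comp hι) (iSup_triSpace G), ne_eq, iSup_eq_bot, not_forall] at h
  obtain ⟨j, hj⟩ := h
  exact ⟨j.1, j.2, hj⟩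

lemma finite_fiber (Q : IsQuotientCartan G M ρ κ) (χ : Dual ℂ M.H) :
    {j | (rootComb G (triContent j)).comp κ = χ}.Finite := by
  have hword (χ : Dual ℂ M.H) :
      {q : List I × I | (rootComb G (wordContent q.1 q.2)).comp κ = χ}.Finite := by
    rcases Set.eq_empty_or_nonempty
      {q : List I × I | (rootComb G (wordContent q.1 q.2)).comp κ = χ} with h | ⟨q₀, hq₀⟩
    · simp [h]
    · refine ((List.finite_length_eq I q₀.1.length).prod Set.finite_univ).subset fun q hq => ?_
      refine ⟨?_, Set.mem_univ _⟩
      have h : (rootComb G (wordContent q.1 q.2)).comp κ =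
        (rootComb G (wordContent q₀.1 q₀.2)).comp κ := hq.trans hq₀.symm
      rw [Q.rootComb_comp, Q.rootComb_comp] at h
      have h := congrArg (fun d => ∑ s, d s) (rootComb_injective M h)
      simp only [sum_fiberSum, sum_wordContent] at h
      change q.1.length = q₀.1.length
      omega
  refine ((Set.finite_singleton none).union (((hword χ).image (some ∘ .inl)).union
    ((hword (-χ)).image (some ∘ .inr)))).subset fun j hj => ?_
  rcases j with _ | q | q
  · exact Or.inl rfl
  · exact Or.inr (Or.inl ⟨q, hj, rfl⟩)
  · refine Or.inr (Or.inr ⟨q, ?_, rfl⟩)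
    rw [Set.mem_ofPred_eq, triContent, map_neg, LinearMap.neg_comp] at hj
    exact neg_eq_iff_eq_neg.mp hj

lemma finiteDimensional_wtSpaceι (Q : IsQuotientCartan G M ρ κ) {ι : M.H →ₗ[ℂ] g}
    (hι : ∀ x, ι x = κ x) (χ : Dual ℂ M.H) : FiniteDimensional ℂ (wtSpaceι ι χ) := by
  rw [wtSpaceι_eq_iSup ι (fun v w => by rw [hι, hι, G.abelian]) (triSpace G) _
    (triSpace_le_wtSpaceι_comp hι) (iSup_triSpace G)]
  have : Finite {j // (rootComb G (triContent j)).comp κ = χ} := Q.finite_fiber χ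
  infer_instance

lemma tri_comp_mem (Q : IsQuotientCartan G M ρ κ) {j} (hj : triSpace G j ≠ ⊥) :
    (rootComb G (triContent j)).comp κ ∈ insert 0 (Delta M) := by
  by_cases h0 : rootComb G (triContent j) = 0
  · left
    rw [h0, LinearMap.zero_comp]
  · exact Or.inr (Q.comp_mem_Delta ⟨h0, ne_bot_of_le_ne_bot hj (triSpace_le G j)⟩)

theorem isFinGrading (Q : IsQuotientCartan G M ρ κ) {φ : m →ₗ⁅ℂ⁆ g}
    (hφ : Function.Injective φ) (hκ : ∀ x : M.H, φ x = κ x) : IsFinGrading M φ := by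
  refine ⟨hφ, top_unique ((iSup_triSpace G).symm.trans_le (iSup_le fun j => ?_)),
    fun χ _ => Q.finiteDimensional_wtSpaceι hκ χ⟩
  rcases eq_or_ne (triSpace G j) ⊥ with h | h
  · simp [h]
  · exact (triSpace_le_wtSpaceι_comp hκ j).trans (le_iSup₂_of_le _ (Q.tri_comp_mem h) le_rfl)

theorem image_Delta (Q : IsQuotientCartan G M ρ κ) {φ : m →ₗ⁅ℂ⁆ g}
    (hφ : Function.Injective φ) (hκ : ∀ x : M.H, φ x = κ x) :
    (fun χ : Dual ℂ G.H => χ.comp κ) '' Delta G = Delta M := by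
  refine Set.Subset.antisymm (Set.image_subset_iff.mpr fun χ => Q.comp_mem_Delta) fun χ hχ => ?_
  obtain ⟨x, hx, hx0⟩ := (Submodule.ne_bot_iff _).mp hχ.2
  have hφx : φ x ∈ wtSpaceι (φ.toLinearMap ∘ₗ M.H.subtype) χ := fun v => by
    have := congrArg φ (hx v)
    rwa [LieHom.map_lie, map_smul] at this
  obtain ⟨j, rfl, hj⟩ := exists_tri_comp_eq hκ
    (wtSpaceι_ne_bot_of_mem hφx ((map_ne_zero_iff φ hφ).mpr hx0))
  refine ⟨_, ⟨fun h0 => hχ.1 ?_, ne_bot_of_le_ne_bot hj (triSpace_le G j)⟩, rfl⟩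
  rw [h0, LinearMap.zero_comp]

end IsQuotientCartan

variable (G M ρ) in
theorem maxFinGrading_of_isQuotientCartan {φ : m →ₗ⁅ℂ⁆ g} (hφ : Function.Injective φ)
    (hle : M.H.map φ.toLinearMap ≤ G.H)
    (Q : IsQuotientCartan G M ρ (cartanIncl G M φ hle)) : MaxFinGrading G M φ := by
  refine ⟨Q.isFinGrading hφ fun _ => rfl, hle, ?_, ?_, ?_⟩
  · rintro χ ⟨hχ, c, rfl⟩
    right
    refine ⟨Q.comp_mem_Delta hχ, fun s => ∑ k with ρ k = s, c k, ?_⟩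
    have hc : ∑ k, (c k : ℂ) • G.root k = rootComb G fun k => (c k : ℤ) := by
      simp only [rootComb_apply, Nat.cast_smul_eq_nsmul]
    rw [resD, hc, Q.rootComb_comp, rootComb_apply]
    refine Finset.sum_congr rfl fun s _ => ?_
    rw [fiberSum, ← Nat.cast_sum, natCast_zsmul, Nat.cast_smul_eq_nsmul]
  · refine Set.eq_empty_of_forall_notMem fun i hi => M.indepRoot.ne_zero (ρ i) ?_
    exact (Q.root i).symm.trans hi
  · exact Set.eq_empty_of_forall_notMem fun i hi => hi.2 (ρ i) (Q.root i)

/-- The Cartan subalgebra of `g^ρ` satisfies the compatibilities of `IsQuotientCartan`. -/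
theorem isQuotientCartan_gRho (hA : ∀ i, A i i = 2)
    (hfiber : ∀ k l, k ≠ l → ρ k = ρ l → A k l = 0) (hB : ∀ s, B s s = 2) {a : Submodule ℂ G.H}
    (ha : ∀ x ∈ a, ∀ k l, ρ k = ρ l → G.root k x = G.root l x)
    {Gρ : KacMoodyAlgebra B (gRho G ρ a)} (hGρ : IsAssocKMrho G ρ a Gρ)
    (hle : Gρ.H.map (gRho G ρ a).incl.toLinearMap ≤ G.H) :
    IsQuotientCartan G Gρ ρ (cartanIncl G Gρ (gRho G ρ a).incl hle) where
  diag := hA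
  diag' := hB
  fiber := hfiber
  root i := by
    obtain ⟨hH, -, he, -⟩ := hGρ
    ext x
    set y := cartanIncl G Gρ (gRho G ρ a).incl hle x with hy
    have hya : y ∈ a := by
      have : (y : g) ∈ a.map G.H.subtype := hH ▸ Submodule.mem_map_of_mem x.2
      obtain ⟨z, hz, hzy⟩ := this
      rwa [← Subtype.ext hzy]
    have hX : Xbar G ρ (ρ i) = ∑ k with ρ k = ρ i, G.e k := by
      rw [Xbar, finsum_mem_eq_sum_of_inter_support_eq]
      simp
    have h1 : ⁅(y : g), Xbar G ρ (ρ i)⁆ = G.root i y • Xbar G ρ (ρ i) := by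
      rw [hX, lie_sum, Finset.smul_sum]
      refine Finset.sum_congr rfl fun k hk => ?_
      rw [G.lie_e, ha y hya k i (Finset.mem_filter.mp hk).2]
    have h2 : ⁅(y : g), Xbar G ρ (ρ i)⁆ = Gρ.root (ρ i) x • Xbar G ρ (ρ i) := by
      have := congrArg (gRho G ρ a).incl (Gρ.lie_e x (ρ i))
      rw [LieHom.map_lie, map_smul] at this
      rw [← he]
      exact this
    have h0 : Xbar G ρ (ρ i) ≠ 0 := by
      rw [← he]
      simpa using e_ne_zero Gρ (ρ i)
    exact smul_left_injective ℂ h0 (h1.symm.trans h2)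
  coroot s := by
    apply Subtype.ext
    refine (hGρ.2.1 s).trans ?_
    rw [gammaV, finsum_mem_eq_sum_of_inter_support_eq]
    simp

end Quotient

end KMG


open KMG

section Statement

attribute [local instance] Classical.propDecidable

variable {I : Type*} [Fintype I] [DecidableEq I] {A : Matrix I I ℤ}
variable {g : Type*} [LieRing g] [LieAlgebra ℂ g]
variable {S : Type*} [Fintype S] [DecidableEq S]

theorem statement19
    (hGCM : IsGCM A) (hInd : Indecomposable A) (hSym : Symmetrizable A)
    (G : KacMoodyAlgebra A g)
    (ρ : I → S) (hadm : AdmissibleQuotient A ρ)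
    (Abar : Matrix S S ℤ) (hdiag : ∀ s, Abar s s = 2)
    (hoff : ∀ s t, s ≠ t → ∀ j, ρ j = t → Abar s t = ∑ᶠ i ∈ {i | ρ i = s}, A i j)
    (a : Submodule ℂ ↥G.H)
    (haG : ∀ x : ↥G.H, x ∈ a → ∀ k l, ρ k = ρ l → G.root k x = G.root l x)
    (hav : ∀ s, gammaV G ρ s ∈ a)
    (γ : S → Module.Dual ℂ ↥a)
    (hγ : ∀ i : I, γ (ρ i) = (G.root i).comp a.subtype)
    (hindep : LinearIndependent ℂ γ)
    (hfd : FiniteDimensional ℂ ↥a)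
    (hdim : Module.finrank ℂ ↥a = 2 * Fintype.card S - (Abar.map ((↑) : ℤ → ℚ)).rank)
    (Gρ : KacMoodyAlgebra Abar ↥(gRho G ρ a)) (hGρ : IsAssocKMrho G ρ a Gρ) :
    MaxFinGrading G Gρ (gRho G ρ a).incl ∧
    ∀ hle : Gρ.H.map (gRho G ρ a).incl.toLinearMap ≤ G.H,
      (fun χ => resD G Gρ (gRho G ρ a).incl hle χ) '' Delta G = Delta Gρ := by
  have hle : Gρ.H.map (gRho G ρ a).incl.toLinearMap ≤ G.H := by
    refine (hGρ.1.trans_le ?_)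
    rintro _ ⟨x, -, rfl⟩
    exact x.2
  have hQ := isQuotientCartan_gRho hGCM.1 hadm.2.1 hdiag haG hGρ
  have hinj : Function.Injective (gRho G ρ a).incl := Subtype.val_injective
  exact ⟨maxFinGrading_of_isQuotientCartan G Gρ ρ hinj hle (hQ hle),
    fun hle' => (hQ hle').image_Delta hinj fun _ => rfl⟩

end Statement
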